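/- arXiv:1601.05990 — 2 statements merged into one kernel-verified Lean document; each statement's English description precedes it below -/
import Mathlib

section
/- Let n, m be positive integers and let (k_t)_{t≥1} be a countable collection of weight vectors. If Θ ∈ ⋂_{t≥1} Bad(k_t,n,m), then for every d with 1 ≤ d ≤ n and every d-dimensional affine subspace A ⊆ ℝⁿ, the Hausdorff dimension of ⋂_{t≥1} Bad_Θ(k_t,n,m) ∩ A equals d. -/
open Real MeasureTheory Topology

/-- Distance from a real number to the nearest integer. -/
noncomputable def distNearestInt (y : ℝ) : ℝ := ⨅ p : ℤ, |y - (p : ℝ)|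

/-- `Θᵢ(q) = ∑ⱼ qⱼ Θᵢⱼ` : the `i`-th linear form of `Θ` evaluated at `q ∈ ℤᵐ`. -/
noncomputable def linForm {n m : ℕ} (Θ : Matrix (Fin n) (Fin m) ℝ) (q : Fin m → ℤ)
    (i : Fin n) : ℝ := ∑ j, (q j : ℝ) * Θ i j

/-- `Θ*ⱼ(u) = ∑ᵢ uᵢ Θᵢⱼ` : the `j`-th linear form of the transposed matrix `Θ*`. -/
noncomputable def dualForm {n m : ℕ} (Θ : Matrix (Fin n) (Fin m) ℝ) (u : Fin n → ℤ)
    (j : Fin m) : ℝ := ∑ i, (u i : ℝ) * Θ i j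

/-- The supremum norm `|q|` of an integer vector. -/
noncomputable def supNorm {m : ℕ} (q : Fin m → ℤ) : ℝ := ⨆ j, |(q j : ℝ)|

/-- A weight vector: positive entries summing to 1. -/
def IsWeight {n : ℕ} (k : Fin n → ℝ) : Prop := (∀ i, 0 < k i) ∧ ∑ i, k i = 1

/-- The set `Bad(k,n,m)` of weighted badly approximable `n × m` matrices:
`inf_{q ∈ ℤᵐ, q ≠ 0} max_{1≤i≤n} |q|^{m kᵢ} ‖Θᵢ(q)‖ > 0`. -/
def Bad (n m : ℕ) (k : Fin n → ℝ) : Set (Matrix (Fin n) (Fin m) ℝ) :=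
  {Θ | ∃ c > 0, ∀ q : Fin m → ℤ, q ≠ 0 →
    c ≤ ⨆ i, supNorm q ^ ((m : ℝ) * k i) * distNearestInt (linForm Θ q i)}

/-- The twisted set `Bad_Θ(k,n,m)`:
`{x ∈ ℝⁿ : inf_{q ∈ ℤᵐ, q ≠ 0} max_{1≤i≤n} |q|^{m kᵢ} ‖Θᵢ(q) − xᵢ‖ > 0}`. -/
def BadT (n m : ℕ) (k : Fin n → ℝ) (Θ : Matrix (Fin n) (Fin m) ℝ) : Set (Fin n → ℝ) :=
  {x | ∃ c > 0, ∀ q : Fin m → ℤ, q ≠ 0 →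
    c ≤ ⨆ i, supNorm q ^ ((m : ℝ) * k i) * distNearestInt (linForm Θ q i - x i)}

/-- The cube of side `(2 * K) ^ (-l)` with lower corner `x`. -/
def gridCube {d : ℕ} (K l : ℕ) (x : Fin d → ℝ) : Set (Fin d → ℝ) :=
  Set.Icc x (fun j => x j + 1 / (2 * K : ℝ) ^ l)

/-- The lower corner of the child, with even multi-index `2 * c`, of the grid cube with corner `x`. -/
noncomputable def childCorner {d K : ℕ} (l : ℕ) (x : Fin d → ℝ) (c : Fin d → Fin K) :
    Fin d → ℝ :=
  fun j => x j + 2 * (c j : ℕ) / (2 * K : ℝ) ^ (l + 1)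

lemma mem_gridCube {d K l : ℕ} {x y : Fin d → ℝ} :
    y ∈ gridCube K l x ↔ ∀ j, x j ≤ y j ∧ y j ≤ x j + 1 / (2 * K : ℝ) ^ l := by
  simp only [gridCube, Set.mem_Icc, Pi.le_def, forall_and]

lemma gridCube_childCorner_subset {d K l : ℕ} (x : Fin d → ℝ) (c : Fin d → Fin K) :
    gridCube K (l + 1) (childCorner l x c) ⊆ gridCube K l x := by
  intro y hy
  rw [mem_gridCube] at hy ⊢
  intro j
  obtain ⟨h1, h2⟩ := hy j
  simp only [childCorner] at h1 h2
  have hcK : ((c j : ℕ) : ℝ) + 1 ≤ K := by exact_mod_cast (c j).2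
  have hK : (0 : ℝ) < 2 * K := by
    have : (0 : ℝ) ≤ ((c j : ℕ) : ℝ) := Nat.cast_nonneg _
    linarith
  have hp : (0 : ℝ) < (2 * K : ℝ) ^ (l + 1) := by positivity
  have hlow : (0 : ℝ) ≤ 2 * (c j : ℕ) / (2 * K : ℝ) ^ (l + 1) := by positivity
  have hside : 2 * (c j : ℕ) / (2 * K : ℝ) ^ (l + 1) + 1 / (2 * K : ℝ) ^ (l + 1)
      ≤ 1 / (2 * K : ℝ) ^ l := by
    have : 1 / (2 * K : ℝ) ^ l = (2 * K) / (2 * K : ℝ) ^ (l + 1) := by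
      have hK0 : (K : ℝ) ≠ 0 := fun h => by simp [h] at hK
      rw [pow_succ]; field_simp
    rw [this, ← add_div]
    gcongr
    linarith
  constructor <;> linarith

lemma le_dist_of_mem_gridCube_childCorner {d K l : ℕ} {x y y' : Fin d → ℝ}
    {c c' : Fin d → Fin K} (hc : c ≠ c') (hy : y ∈ gridCube K (l + 1) (childCorner l x c))
    (hy' : y' ∈ gridCube K (l + 1) (childCorner l x c')) :
    1 / (2 * K : ℝ) ^ (l + 1) ≤ dist y y' := by
  obtain ⟨j, hj⟩ := Function.ne_iff.1 hc
  refine le_trans ?_ (dist_le_pi_dist y y' j)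
  obtain ⟨h1, h2⟩ := mem_gridCube.1 hy j
  obtain ⟨h3, h4⟩ := mem_gridCube.1 hy' j
  simp only [childCorner] at h1 h2 h3 h4
  set r : ℝ := 1 / (2 * K : ℝ) ^ (l + 1) with hr
  have hr0 : 0 ≤ r := by positivity
  have e : ∀ a : ℝ, 2 * a / (2 * K : ℝ) ^ (l + 1) = 2 * a * r := fun a => by rw [hr]; ring
  rw [e] at h1 h2 h3 h4
  rw [Real.dist_eq]
  rcases lt_or_gt_of_ne (fun h => hj (Fin.ext h) : ((c j : ℕ)) ≠ (c' j : ℕ)) with h | h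
  · have : ((c j : ℕ) : ℝ) + 1 ≤ (c' j : ℕ) := by exact_mod_cast h
    rw [abs_sub_comm]
    refine le_trans ?_ (le_abs_self _)
    nlinarith
  · have : ((c' j : ℕ) : ℝ) + 1 ≤ (c j : ℕ) := by exact_mod_cast h
    refine le_trans ?_ (le_abs_self _)
    nlinarith

/-- A map on the symbolic space `ℕ → Fin M` which separates sequences first differing at index `l`
by at least `N^{-(l+1)}` has range of Hausdorff dimension at least `log M / log N`. -/
lemma le_dimH_range_of_separated {X : Type*} [MetricSpace X] {M : ℕ} (hM : 2 ≤ M) {N : ℝ}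
    (hN : 1 < N) (f : (ℕ → Fin M) → X)
    (hf : ∀ (w v : ℕ → Fin M) (l : ℕ), (∀ i < l, w i = v i) → w l ≠ v l →
      1 / N ^ (l + 1) ≤ dist (f w) (f v)) :
    ENNReal.ofReal (Real.log M / Real.log N) ≤ dimH (Set.range f) := by
  have hM' : (1 : ℝ) < M := by exact_mod_cast hM
  have hlM := Real.log_pos hM'
  have hlN := Real.log_pos hN
  set s : ℝ := Real.log M / Real.log N with hs
  have hs0 : 0 < s := div_pos hlM hlN
  have hNs : N ^ s = M := by
    rw [Real.rpow_def_of_pos (by linarith), hs, mul_div_cancel₀ _ hlN.ne',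
      Real.exp_log (by linarith)]
  have key : ∀ w v, |Real.ofDigits w - Real.ofDigits v| ≤ M * dist (f w) (f v) ^ s := by
    intro w v
    by_cases hwv : w = v
    · subst hwv
      simp [Real.zero_rpow hs0.ne']
    have hex : ∃ l, w l ≠ v l := Function.ne_iff.1 hwv
    classical
    set l := Nat.find hex with hl
    have h1 : ∀ i < l, w i = v i := fun i hi => not_not.1 (Nat.find_min hex hi)
    have h2 := hf w v l h1 (Nat.find_spec hex)
    refine (Real.abs_ofDigits_sub_ofDigits_le h1).trans ?_
    have h3 : (1 / N ^ (l + 1)) ^ s ≤ dist (f w) (f v) ^ s :=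
      Real.rpow_le_rpow (by positivity) h2 hs0.le
    have h4 : (1 / N ^ (l + 1)) ^ s = 1 / (M : ℝ) ^ (l + 1) := by
      rw [Real.div_rpow zero_le_one (by positivity), Real.one_rpow, ← Real.rpow_natCast N,
        ← Real.rpow_mul (by linarith), mul_comm, Real.rpow_mul (by linarith), hNs,
        Real.rpow_natCast]
    rw [h4] at h3
    calc ((M : ℝ) ^ l)⁻¹ = M * (1 / (M : ℝ) ^ (l + 1)) := by rw [pow_succ]; field_simp
      _ ≤ _ := by gcongr
  have hinj : ∀ w v, f w = f v → Real.ofDigits w = Real.ofDigits v := by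
    intro w v h
    have := key w v
    rw [h, dist_self, Real.zero_rpow hs0.ne', mul_zero] at this
    exact sub_eq_zero.1 (abs_eq_zero.1 (le_antisymm this (abs_nonneg _)))
  have : Nonempty (ℕ → Fin M) := ⟨fun _ => ⟨0, by omega⟩⟩
  set g : X → ℝ := fun x => Real.ofDigits (Function.invFun f x) with hg
  have hgf : ∀ w, g (f w) = Real.ofDigits w := fun w =>
    hinj _ _ (Function.invFun_eq ⟨w, rfl⟩)
  have hhol : HolderOnWith (M : NNReal) s.toNNReal g (Set.range f) := by
    rintro _ ⟨w, rfl⟩ _ ⟨v, rfl⟩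
    rw [hgf, hgf, edist_dist, edist_dist, Real.coe_toNNReal _ hs0.le,
      ENNReal.ofReal_rpow_of_nonneg dist_nonneg hs0.le]
    have : ((M : NNReal) : ENNReal) = ENNReal.ofReal (M : ℝ) := by simp
    rw [this, ← ENNReal.ofReal_mul (by positivity)]
    exact ENNReal.ofReal_le_ofReal (by rw [Real.dist_eq]; exact key w v)
  have himg : Set.Icc (0 : ℝ) 1 ⊆ g '' Set.range f := by
    intro y hy
    obtain ⟨w, -, hw⟩ := Real.ofDigits_SurjOn (b := M) (by omega) hy
    exact ⟨f w, ⟨w, rfl⟩, (hgf w).trans hw⟩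
  have hone : dimH (Set.Icc (0 : ℝ) 1) = 1 := by
    rw [Real.dimH_of_nonempty_interior (by simp [interior_Icc])]
    simp
  have h5 := (dimH_mono himg).trans (hhol.dimH_image_le (Real.toNNReal_pos.2 hs0))
  rw [hone, ENNReal.le_div_iff_mul_le (Or.inl (by simpa using hs0)) (Or.inl (by simp)),
    one_mul] at h5
  exact h5

/-- Lower bound for the Hausdorff dimension of `⋂ l, G l` when every grid cube of level `l` has at
least `M` (mutually separated) children contained in `G l`. -/
lemma le_dimH_iInter_of_children {d K M : ℕ} (hK : 1 ≤ K) (hM : 2 ≤ M)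
    (G : ℕ → Set (Fin d → ℝ))
    (hG : ∀ l x, ∃ S : Finset (Fin d → Fin K), M ≤ S.card ∧
      ∀ c ∈ S, gridCube K (l + 1) (childCorner l x c) ⊆ G l) :
    ENNReal.ofReal (Real.log M / Real.log (2 * K)) ≤ dimH (⋂ l, G l) := by
  have hK' : (1 : ℝ) ≤ K := by exact_mod_cast hK
  have hG' : ∀ l x, ∃ e : Fin M → (Fin d → Fin K), Function.Injective e ∧
      ∀ a, gridCube K (l + 1) (childCorner l x (e a)) ⊆ G l := by
    intro l x
    obtain ⟨S, hS, h⟩ := hG l x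
    refine ⟨fun a => (S.equivFin.symm (Fin.castLE hS a) : Fin d → Fin K), ?_, ?_⟩
    · intro a b hab
      exact Fin.castLE_injective hS (S.equivFin.symm.injective (Subtype.ext hab))
    · intro a
      exact h _ (S.equivFin.symm (Fin.castLE hS a)).2
  choose e he heG using hG'
  let corner : (ℕ → Fin M) → ℕ → (Fin d → ℝ) := fun w l =>
    Nat.rec 0 (fun l x => childCorner l x (e l x (w l))) l
  have hsucc : ∀ w l, corner w (l + 1) =
      childCorner l (corner w l) (e l (corner w l) (w l)) := fun _ _ => rfl
  have hagree : ∀ (w v : ℕ → Fin M) (l : ℕ), (∀ i < l, w i = v i) → corner w l = corner v l := by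
    intro w v l
    induction l with
    | zero => intro _; rfl
    | succ l ih =>
      intro h
      rw [hsucc, hsucc, ih fun i hi => h i (by omega), h l (by omega)]
  have hne : ∀ w, (⋂ l, gridCube K l (corner w l)).Nonempty := by
    intro w
    apply IsCompact.nonempty_iInter_of_sequence_nonempty_isCompact_isClosed
    · intro l
      rw [hsucc]
      exact gridCube_childCorner_subset _ _
    · intro l
      refine ⟨corner w l, mem_gridCube.2 fun j => ⟨le_rfl, ?_⟩⟩
      have : (0 : ℝ) ≤ 1 / (2 * K : ℝ) ^ l := by positivity
      linarith
    · exact isCompact_Icc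
    · intro l
      exact isClosed_Icc
  choose f hf using hne
  have hf' : ∀ w l, f w ∈ gridCube K l (corner w l) := fun w => Set.mem_iInter.1 (hf w)
  have hsub : Set.range f ⊆ ⋂ l, G l := by
    rintro _ ⟨w, rfl⟩
    refine Set.mem_iInter.2 fun l => heG l (corner w l) (w l) ?_
    rw [← hsucc]
    exact hf' w (l + 1)
  refine le_trans ?_ (dimH_mono hsub)
  refine le_dimH_range_of_separated hM (by linarith) f fun w v l hl hne => ?_
  have h1 := hf' w (l + 1)
  have h2 := hf' v (l + 1)
  rw [hsucc] at h1 h2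
  rw [← hagree w v l hl] at h2
  exact le_dist_of_mem_gridCube_childCorner (fun h => hne (he l _ h)) h1 h2

/-- Most children of a grid cube avoid a slab of thickness comparable to their side. -/
lemma exists_children_avoiding_slab {d K : ℕ} (hK : 1 ≤ K) (φ : Fin d → ℝ)
    (hφ : 0 < ∑ j, |φ j|) (a : ℝ) (l : ℕ) (x : Fin d → ℝ) :
    ∃ S : Finset (Fin d → Fin K), K ^ (d - 1) * (K - 2 * d) ≤ S.card ∧
      ∀ c ∈ S, ∀ y ∈ gridCube K (l + 1) (childCorner l x c),
        (∑ j, |φ j|) * (1 / (2 * K : ℝ) ^ (l + 1)) ≤ |∑ j, φ j * y j - a| := by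
  classical
  have hK' : (1 : ℝ) ≤ K := by exact_mod_cast hK
  set L := ∑ j, |φ j| with hL
  set r : ℝ := 1 / (2 * K : ℝ) ^ (l + 1) with hr
  have hr0 : 0 < r := by positivity
  have hd : 0 < d := by
    rcases Nat.eq_zero_or_pos d with rfl | h
    · simp [hL] at hφ
    · exact h
  have : Nonempty (Fin d) := ⟨⟨0, hd⟩⟩
  obtain ⟨j₀, -, hj₀⟩ := Finset.exists_max_image Finset.univ (fun j => |φ j|)
    Finset.univ_nonempty
  have hLj : L ≤ d * |φ j₀| := by
    have := Finset.sum_le_card_nsmul Finset.univ (fun j => |φ j|) (|φ j₀|) hj₀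
    simpa using this
  have hφj : 0 < |φ j₀| := by
    by_contra h
    have : (d : ℝ) * |φ j₀| ≤ 0 := mul_nonpos_of_nonneg_of_nonpos (by positivity) (not_lt.1 h)
    linarith
  set ev : (Fin d → Fin K) → ℝ := fun c => ∑ j, φ j * childCorner l x c j with hev
  set B : Finset (Fin d → Fin K) := Finset.univ.filter fun c => |ev c - a| < 2 * L * r with hB
  have hBcard : B.card ≤ K ^ (d - 1) * (2 * d) := by
    let F : (Fin d → Fin K) → ({j : Fin d // j ≠ j₀} → Fin K) × Fin (2 * d) :=
      fun c => (fun j => c j, ⟨(c j₀ : ℕ) % (2 * d), Nat.mod_lt _ (by omega)⟩)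
    have hF : Set.InjOn F B := by
      intro c hc c' hc' h
      have hc1 : |ev c - a| < 2 * L * r := (Finset.mem_filter.1 hc).2
      have hc2 : |ev c' - a| < 2 * L * r := (Finset.mem_filter.1 hc').2
      obtain ⟨h1, h2⟩ := Prod.ext_iff.1 h
      have h1' : ∀ j, j ≠ j₀ → c j = c' j := fun j hj => congrFun h1 ⟨j, hj⟩
      have h2' : (c j₀ : ℕ) % (2 * d) = (c' j₀ : ℕ) % (2 * d) := congrArg Fin.val h2
      have hdiff : ev c - ev c' = φ j₀ * (2 * r * (((c j₀ : ℕ) : ℝ) - (c' j₀ : ℕ))) := by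
        simp only [hev, ← Finset.sum_sub_distrib]
        rw [Finset.sum_eq_single j₀]
        · simp only [childCorner, hr]; ring
        · intro j _ hj
          simp only [childCorner, h1' j hj, sub_self]
        · simp
      have habs : |ev c - ev c'| < 4 * L * r := by
        have := abs_sub_le (ev c) a (ev c')
        rw [abs_sub_comm a] at this
        linarith
      rw [hdiff, abs_mul, abs_mul, abs_of_pos (show 0 < 2 * r by positivity)] at habs
      set D : ℝ := |((c j₀ : ℕ) : ℝ) - (c' j₀ : ℕ)| with hD
      have hD2 : D < 2 * d := by
        have h3 : (2 * r * |φ j₀|) * D < (2 * r * |φ j₀|) * (2 * d) := by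
          have := mul_le_mul_of_nonneg_left hLj (show 0 ≤ 4 * r by positivity)
          nlinarith
        exact lt_of_mul_lt_mul_left h3 (by positivity)
      have hD3 : |((c j₀ : ℕ) : ℤ) - ((c' j₀ : ℕ) : ℤ)| < ((2 * d : ℕ) : ℤ) := by
        have : ((|((c j₀ : ℕ) : ℤ) - ((c' j₀ : ℕ) : ℤ)| : ℤ) : ℝ) < ((2 * d : ℕ) : ℤ) := by
          push_cast
          exact hD2
        exact_mod_cast this
      have hmod : ((c j₀ : ℕ) : ℤ) ≡ ((c' j₀ : ℕ) : ℤ) [ZMOD ((2 * d : ℕ) : ℤ)] :=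
        (Int.natCast_modEq_iff).2 h2'
      have hz := Int.eq_zero_of_abs_lt_dvd hmod.symm.dvd hD3
      funext j
      by_cases hj : j = j₀
      · subst hj
        exact Fin.ext (by omega)
      · exact h1' j hj
    have := Finset.card_le_card_of_injOn (t := Finset.univ) F (fun _ _ => Finset.mem_univ _) hF
    simpa [Fintype.card_subtype_compl] using this
  refine ⟨Bᶜ, ?_, ?_⟩
  · rw [Finset.card_compl]
    simp only [Fintype.card_pi, Fintype.card_fin, Finset.prod_const, Finset.card_univ]
    rw [Nat.mul_sub, ← pow_succ, Nat.sub_add_cancel hd]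
    exact Nat.sub_le_sub_left hBcard _
  · intro c hc y hy
    have hc1 : 2 * L * r ≤ |ev c - a| := by
      simpa [hB] using hc
    have hclose : |ev c - ∑ j, φ j * y j| ≤ L * r := by
      simp only [hev, ← Finset.sum_sub_distrib, ← mul_sub]
      refine (Finset.abs_sum_le_sum_abs _ _).trans ?_
      rw [hL, Finset.sum_mul]
      refine Finset.sum_le_sum fun j _ => ?_
      rw [abs_mul]
      gcongr
      obtain ⟨h1, h2⟩ := mem_gridCube.1 hy j
      rw [abs_le]
      constructor <;> linarith
    have := abs_sub_le (ev c) (∑ j, φ j * y j) a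
    linarith

lemma exists_branching_log_ratio_ge {d : ℕ} (hd : 1 ≤ d) {s : ℝ} (hs : s < d) :
    ∃ K M : ℕ, 1 ≤ K ∧ 2 ≤ M ∧ M ≤ K ^ (d - 1) * (K - 2 * d) ∧
      s ≤ Real.log M / Real.log (2 * K) := by
  obtain ⟨p₀, hp₀⟩ := exists_nat_ge ((s + 1) / (d - s))
  set p := max p₀ (4 * d) with hp
  have hp4 : 4 * d ≤ p := le_max_right _ _
  have hpd : (s + 1) ≤ p * (d - s) := by
    have h1 : ((p₀ : ℕ) : ℝ) ≤ p := by exact_mod_cast le_max_left _ _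
    have := hp₀.trans h1
    rwa [div_le_iff₀ (by linarith)] at this
  have hK4 : 4 * d ≤ 2 ^ p := hp4.trans Nat.lt_two_pow_self.le
  have hpd1 : 4 ≤ p * d := by nlinarith
  refine ⟨2 ^ p, 2 ^ (p * d - 1), Nat.one_le_two_pow, ?_, ?_, ?_⟩
  · calc 2 = 2 ^ 1 := by norm_num
      _ ≤ 2 ^ (p * d - 1) := Nat.pow_le_pow_right (by norm_num) (by omega)
  · have h1 : 2 ^ (p * d - 1) * 2 = (2 ^ p) ^ (d - 1) * 2 ^ p := by
      rw [← pow_succ, ← pow_succ, ← pow_mul, Nat.sub_add_cancel hd,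
        Nat.sub_add_cancel (by omega)]
    have h2 : 2 ^ p ≤ 2 * (2 ^ p - 2 * d) := by omega
    have h3 := Nat.mul_le_mul_left ((2 ^ p) ^ (d - 1)) h2
    rw [← h1] at h3
    nlinarith
  · have hl2 : 0 < Real.log 2 := Real.log_pos (by norm_num)
    push_cast
    rw [← pow_succ', Real.log_pow, Real.log_pow, mul_div_mul_right _ _ hl2.ne']
    push_cast [Nat.cast_sub (show 1 ≤ p * d by omega)]
    rw [le_div_iff₀ (by positivity)]
    linarith

lemma distNearestInt_eq (y : ℝ) : distNearestInt y = |y - round y| :=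
  le_antisymm (ciInf_le ⟨0, by rintro _ ⟨p, rfl⟩; exact abs_nonneg _⟩ (round y))
    (le_ciInf fun p => round_le y p)

lemma distNearestInt_le (y : ℝ) (p : ℤ) : distNearestInt y ≤ |y - p| := by
  rw [distNearestInt_eq]
  exact round_le y p

lemma distNearestInt_nonneg (y : ℝ) : 0 ≤ distNearestInt y := by
  rw [distNearestInt_eq]
  exact abs_nonneg _

lemma abs_le_supNorm {m : ℕ} (q : Fin m → ℤ) (j : Fin m) : |(q j : ℝ)| ≤ supNorm q :=
  le_ciSup (f := fun j => |(q j : ℝ)|) (Set.finite_range _).bddAbove j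

lemma one_le_supNorm {m : ℕ} {q : Fin m → ℤ} (hq : q ≠ 0) : 1 ≤ supNorm q := by
  obtain ⟨j, hj⟩ := Function.ne_iff.1 hq
  refine le_trans ?_ (abs_le_supNorm q j)
  exact_mod_cast Int.one_le_abs hj

lemma supNorm_sub_le {m : ℕ} (hm : 0 < m) (q q' : Fin m → ℤ) :
    supNorm (q - q') ≤ supNorm q + supNorm q' := by
  have : Nonempty (Fin m) := ⟨⟨0, hm⟩⟩
  refine ciSup_le fun j => ?_
  have := abs_sub (q j : ℝ) (q' j)
  have h1 := abs_le_supNorm q j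
  have h2 := abs_le_supNorm q' j
  rw [Pi.sub_apply, Int.cast_sub]
  linarith

lemma linForm_sub {n m : ℕ} (Θ : Matrix (Fin n) (Fin m) ℝ) (q q' : Fin m → ℤ) (i : Fin n) :
    linForm Θ (q - q') i = linForm Θ q i - linForm Θ q' i := by
  simp only [linForm, ← Finset.sum_sub_distrib]
  refine Finset.sum_congr rfl fun j _ => ?_
  rw [Pi.sub_apply, Int.cast_sub]
  ring

lemma exists_le_of_le_iSup_fin {n : ℕ} (hn : 0 < n) {c : ℝ} {f : Fin n → ℝ} (h : c ≤ ⨆ i, f i) :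
    ∃ i, c ≤ f i := by
  have : Nonempty (Fin n) := ⟨⟨0, hn⟩⟩
  obtain ⟨i, hi⟩ := exists_eq_ciSup_of_finite (f := f)
  exact ⟨i, hi ▸ h⟩

lemma IsWeight.le_one {n : ℕ} {k : Fin n → ℝ} (hk : IsWeight k) (i : Fin n) : k i ≤ 1 := by
  rw [← hk.2]
  exact Finset.single_le_sum (fun j _ => (hk.1 j).le) (Finset.mem_univ i)

/-- The points `x` which satisfy the defining inequality of `BadT` with constant `c` at height `Q`,
for all `q` of norm at most `Q`. -/
def AvoidsUpTo {n m : ℕ} (k : Fin n → ℝ) (Θ : Matrix (Fin n) (Fin m) ℝ) (c Q : ℝ)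
    (x : Fin n → ℝ) : Prop :=
  ∀ q : Fin m → ℤ, q ≠ 0 → supNorm q ≤ Q →
    ∃ i, c ≤ Q ^ ((m : ℝ) * k i) * distNearestInt (linForm Θ q i - x i)

/-- The affine map with translation part `b` and linear part `φ`. -/
def affineParam {n d : ℕ} (b : Fin n → ℝ) (φ : Fin n → Fin d → ℝ) (y : Fin d → ℝ) : Fin n → ℝ :=
  fun i => b i + ∑ j, φ i j * y j

lemma abs_affineParam_sub_le {n d K l : ℕ} (b : Fin n → ℝ) (φ : Fin n → Fin d → ℝ)
    {x y y' : Fin d → ℝ} (hy : y ∈ gridCube K l x) (hy' : y' ∈ gridCube K l x) (i : Fin n) :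
    |affineParam b φ y i - affineParam b φ y' i| ≤ (∑ j, |φ i j|) * (1 / (2 * K : ℝ) ^ l) := by
  simp only [affineParam, add_sub_add_left_eq_sub, ← Finset.sum_sub_distrib, ← mul_sub]
  refine (Finset.abs_sum_le_sum_abs _ _).trans ?_
  rw [Finset.sum_mul]
  refine Finset.sum_le_sum fun j _ => ?_
  rw [abs_mul]
  gcongr
  obtain ⟨h1, h2⟩ := mem_gridCube.1 hy j
  obtain ⟨h3, h4⟩ := mem_gridCube.1 hy' j
  rw [abs_le]
  constructor <;> linarith

/-- Within a grid cube that is small compared with the separation of the points `Θ q + p`,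
`|q| ≤ Q`, the condition `AvoidsUpTo` holds outside a single slab. -/
lemma exists_slab_of_scale {n m d K l : ℕ} (hm : 0 < m) {k : Fin n → ℝ} (hk : IsWeight k)
    {Θ : Matrix (Fin n) (Fin m) ℝ} {c : ℝ} (hc1 : c ≤ 1)
    (hΘ : ∀ q : Fin m → ℤ, q ≠ 0 →
      ∃ i, c ≤ supNorm q ^ ((m : ℝ) * k i) * distNearestInt (linForm Θ q i))
    (b : Fin n → ℝ) (φ : Fin n → Fin d → ℝ) {Q c₂ : ℝ} (hQ : 0 < Q)
    (hscale : ∀ i, (∑ j, |φ i j|) * (1 / (2 * K : ℝ) ^ l) * Q ^ ((m : ℝ) * k i)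
      ≤ c / (3 * 2 ^ m))
    (hc₂ : c₂ ≤ c / (3 * 2 ^ m)) (i₀ : Fin n) (x : Fin d → ℝ) :
    ∃ a : ℝ, ∀ y ∈ gridCube K l x,
      c₂ ≤ Q ^ ((m : ℝ) * k i₀) * |∑ j, φ i₀ j * y j - a| →
        AvoidsUpTo k Θ c₂ Q (affineParam b φ y) := by
  by_cases hall : ∀ y ∈ gridCube K l x, AvoidsUpTo k Θ c₂ Q (affineParam b φ y)
  · exact ⟨0, fun y hy _ => hall y hy⟩
  push Not at hall
  obtain ⟨y₀, hy₀, hbad₀⟩ := hall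
  simp only [AvoidsUpTo] at hbad₀
  push Not at hbad₀
  obtain ⟨q₀, hq₀, hq₀Q, hbad₀⟩ := hbad₀
  set c₁ := c / (3 * 2 ^ m) with hc₁
  have h2m : (1 : ℝ) ≤ 2 ^ m := one_le_pow₀ (by norm_num)
  have hcc : 2 ^ m * (3 * c₁) = c := by
    rw [hc₁]; field_simp
  have hu : ∀ i, 0 < Q ^ ((m : ℝ) * k i) := fun i => Real.rpow_pos_of_pos hQ _
  set p₀ := round (linForm Θ q₀ i₀ - affineParam b φ y₀ i₀) with hp₀
  refine ⟨linForm Θ q₀ i₀ - p₀ - b i₀, fun y hy hslab => ?_⟩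
  by_contra hbad
  simp only [AvoidsUpTo] at hbad
  push Not at hbad
  obtain ⟨q, hq, hqQ, hbad⟩ := hbad
  have hdiff : ∀ i, Q ^ ((m : ℝ) * k i) *
      |(linForm Θ q i - linForm Θ q₀ i) - (round (linForm Θ q i - affineParam b φ y i) -
        round (linForm Θ q₀ i - affineParam b φ y₀ i) : ℝ)| < 3 * c₁ := by
    intro i
    have h1 := hbad i
    have h2 := hbad₀ i
    rw [distNearestInt_eq] at h1 h2
    have h3 := abs_affineParam_sub_le b φ hy hy₀ i
    have h4 := hscale i
    have h5 : ∀ s t u v w z : ℝ, |(s - t) - (u - v)| ≤ |s - w - u| + |t - z - v| + |w - z| := by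
      intro s t u v w z
      have e : (s - t) - (u - v) = (s - w - u) - (t - z - v) + (w - z) := by ring
      rw [e]
      exact (abs_add_le _ _).trans (by gcongr; exact abs_sub _ _)
    have h6 := h5 (linForm Θ q i) (linForm Θ q₀ i) (round (linForm Θ q i - affineParam b φ y i))
      (round (linForm Θ q₀ i - affineParam b φ y₀ i)) (affineParam b φ y i) (affineParam b φ y₀ i)
    have h7 := mul_le_mul_of_nonneg_left (h6.trans (by gcongr : _ ≤ _ + _ +
      (∑ j, |φ i j|) * (1 / (2 * K : ℝ) ^ l))) (hu i).le
    linarith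
  have hqq : q = q₀ := by
    by_contra hne
    obtain ⟨i, hi⟩ := hΘ (q - q₀) (sub_ne_zero.2 hne)
    have hs : supNorm (q - q₀) ≤ 2 * Q := by linarith [supNorm_sub_le hm q q₀]
    have hs0 : 0 ≤ supNorm (q - q₀) :=
      zero_le_one.trans (one_le_supNorm (sub_ne_zero.2 hne))
    have he : 0 ≤ (m : ℝ) * k i := mul_nonneg (Nat.cast_nonneg _) (hk.1 i).le
    have hpow : supNorm (q - q₀) ^ ((m : ℝ) * k i) ≤ 2 ^ m * Q ^ ((m : ℝ) * k i) := by
      refine (Real.rpow_le_rpow hs0 hs he).trans ?_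
      rw [Real.mul_rpow (by norm_num) hQ.le]
      gcongr
      rw [← Real.rpow_natCast]
      exact Real.rpow_le_rpow_of_exponent_le (by norm_num)
        (mul_le_of_le_one_right (Nat.cast_nonneg _) (hk.le_one i))
    have hd := distNearestInt_le (linForm Θ (q - q₀) i)
      (round (linForm Θ q i - affineParam b φ y i) -
        round (linForm Θ q₀ i - affineParam b φ y₀ i))
    rw [linForm_sub, Int.cast_sub] at hd
    rw [linForm_sub] at hi
    have h1 := mul_le_mul hpow hd (distNearestInt_nonneg _) (by positivity)
    have h2 := mul_lt_mul_of_pos_left (hdiff i) (show (0 : ℝ) < 2 ^ m by positivity)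
    rw [hcc, ← mul_assoc] at h2
    linarith
  subst hqq
  have hQ1 : 1 ≤ Q ^ ((m : ℝ) * k i₀) :=
    Real.one_le_rpow ((one_le_supNorm hq).trans hqQ)
      (mul_nonneg (Nat.cast_nonneg _) (hk.1 i₀).le)
  have hpp : round (linForm Θ q i₀ - affineParam b φ y i₀) = p₀ := by
    have h1 := hdiff i₀
    rw [sub_self, zero_sub, abs_neg, ← hp₀] at h1
    have h3 : 3 * c₁ ≤ 1 := by
      have hc' : 3 * c₁ = c / 2 ^ m := by rw [hc₁]; field_simp
      rw [hc', div_le_one (by positivity)]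
      linarith
    have h2 : |((round (linForm Θ q i₀ - affineParam b φ y i₀) : ℤ) : ℝ) - (p₀ : ℤ)| < 1 := by
      have := le_mul_of_one_le_left
        (abs_nonneg (((round (linForm Θ q i₀ - affineParam b φ y i₀) : ℤ) : ℝ) - (p₀ : ℤ))) hQ1
      linarith
    have h4 : |round (linForm Θ q i₀ - affineParam b φ y i₀) - p₀| < 1 := by
      exact_mod_cast h2
    have := Int.abs_lt_one_iff.1 h4
    omega
  have h1 := hbad i₀
  rw [distNearestInt_eq, hpp, abs_sub_comm] at h1
  have e : (p₀ : ℝ) - (linForm Θ q i₀ - affineParam b φ y i₀) =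
      ∑ j, φ i₀ j * y j - (linForm Θ q i₀ - p₀ - b i₀) := by
    simp only [affineParam]; ring
  rw [e] at h1
  linarith

lemma exists_scale {n : ℕ} {L e : Fin n → ℝ} (hL0 : ∀ i, 0 ≤ L i) (hL : ∃ i, 0 < L i)
    (he : ∀ i, 0 < e i) {c ρ : ℝ} (hc : 0 < c) (hρ : 0 < ρ) :
    ∃ Q : ℝ, 0 < Q ∧ (∀ i, L i * ρ * Q ^ e i ≤ c) ∧ ∃ i, 0 < L i ∧ L i * ρ * Q ^ e i = c := by
  classical
  obtain ⟨i', hi'⟩ := hL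
  obtain ⟨i, hi, hmin⟩ := Finset.exists_min_image (Finset.univ.filter fun i => 0 < L i)
    (fun i => (c / (L i * ρ)) ^ (e i)⁻¹) ⟨i', by simpa using hi'⟩
  have hi0 : 0 < L i := (Finset.mem_filter.1 hi).2
  have hpow : ∀ j, 0 < L j → L j * ρ * ((c / (L j * ρ)) ^ (e j)⁻¹) ^ e j = c := by
    intro j hj
    rw [← Real.rpow_mul (by positivity), inv_mul_cancel₀ (he j).ne', Real.rpow_one]
    field_simp
  refine ⟨(c / (L i * ρ)) ^ (e i)⁻¹, by positivity, fun j => ?_, i, hi0, hpow i hi0⟩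
  rcases (hL0 j).eq_or_lt with h | h
  · rw [← h]
    simpa using hc.le
  · refine le_of_le_of_eq ?_ (hpow j h)
    have := hmin j (by simpa using h)
    have hj := he j
    gcongr

/-- Scales attached to a geometric sequence of side lengths grow at most geometrically and are
unbounded. -/
lemma scale_growth {n : ℕ} {L e : Fin n → ℝ} (hL0 : ∀ i, 0 ≤ L i) (he : ∀ i, 0 < e i) {c R : ℝ}
    (hc : 0 < c) (hR : 1 < R) {ρ Q : ℕ → ℝ} (hρ : ∀ j, 0 < ρ j) (hρR : ∀ j, ρ j = R * ρ (j + 1))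
    (hQ : ∀ j, 0 < Q j) (hle : ∀ j i, L i * ρ j * Q j ^ e i ≤ c)
    (heq : ∀ j, ∃ i, 0 < L i ∧ L i * ρ j * Q j ^ e i = c) :
    (∃ C, ∀ j, Q (j + 1) ≤ C * Q j) ∧ ∀ X, ∃ j, X ≤ Q j := by
  constructor
  · refine ⟨∑ i, R ^ (e i)⁻¹, fun j => ?_⟩
    obtain ⟨i, hi, h⟩ := heq j
    have hei := he i
    have h1 := hle (j + 1) i
    have h2 : Q (j + 1) ^ e i ≤ R * Q j ^ e i := by
      rw [← h, hρR j] at h1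
      have hpos : 0 < L i * ρ (j + 1) := mul_pos hi (hρ _)
      refine le_of_mul_le_mul_left ?_ hpos
      linarith
    have h3 : R * Q j ^ e i = (R ^ (e i)⁻¹ * Q j) ^ e i := by
      rw [Real.mul_rpow (by positivity) (hQ j).le, ← Real.rpow_mul (by linarith),
        inv_mul_cancel₀ hei.ne', Real.rpow_one]
    rw [h3] at h2
    have h4 := (Real.rpow_le_rpow_iff (hQ _).le
      (mul_nonneg (Real.rpow_nonneg (by linarith) _) (hQ j).le) hei).1 h2
    refine h4.trans (mul_le_mul_of_nonneg_right ?_ (hQ j).le)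
    exact Finset.single_le_sum (f := fun i => R ^ (e i)⁻¹)
      (fun i _ => Real.rpow_nonneg (by linarith) _) (Finset.mem_univ i)
  · intro X
    by_cases hX : X ≤ 0
    · exact ⟨0, hX.trans (hQ 0).le⟩
    push Not at hX
    set W := ∑ i, L i * X ^ e i with hW
    have hρ' : ∀ j, ρ j = ρ 0 / R ^ j := by
      intro j
      induction j with
      | zero => simp
      | succ j ih =>
        have : R ≠ 0 := by linarith
        have h1 := hρR j
        rw [ih] at h1
        rw [pow_succ]
        field_simp
        field_simp at h1
        linarith
    obtain ⟨j, hj⟩ := pow_unbounded_of_one_lt (ρ 0 * W / c) hR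
    refine ⟨j, not_lt.1 fun hlt => ?_⟩
    obtain ⟨i, hi, h⟩ := heq j
    have h1 : L i * X ^ e i ≤ W := Finset.single_le_sum (f := fun i => L i * X ^ e i)
      (fun i _ => mul_nonneg (hL0 i) (Real.rpow_nonneg hX.le _)) (Finset.mem_univ i)
    have h2 : Q j ^ e i ≤ X ^ e i := Real.rpow_le_rpow (hQ j).le hlt.le (he i).le
    have h3 : c ≤ ρ j * W := by
      calc c = ρ j * (L i * Q j ^ e i) := by rw [← h]; ring
        _ ≤ ρ j * (L i * X ^ e i) := by have := hρ j; gcongr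
        _ ≤ ρ j * W := mul_le_mul_of_nonneg_left h1 (hρ j).le
    rw [hρ' j] at h3
    have hRj : 0 < R ^ j := by positivity
    rw [div_lt_iff₀ hc] at hj
    rw [div_mul_eq_mul_div, le_div_iff₀ hRj] at h3
    linarith

lemma mem_badT_of_avoidsUpTo {n m : ℕ} {k : Fin n → ℝ} (hk : IsWeight k)
    {Θ : Matrix (Fin n) (Fin m) ℝ} {x : Fin n → ℝ} {c C : ℝ} (hc : 0 < c) {Q : ℕ → ℝ}
    (hQ : ∀ j, 0 < Q j) (hC : ∀ j, Q (j + 1) ≤ C * Q j) (hunb : ∀ X, ∃ j, X ≤ Q j)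
    (h : ∀ j, AvoidsUpTo k Θ c (Q j) x) : x ∈ BadT n m k Θ := by
  set D := max 1 (max C (Q 0)) with hD
  have hD1 : 1 ≤ D := le_max_left _ _
  have hDC : C ≤ D := (le_max_left _ _).trans (le_max_right _ _)
  have hDQ : Q 0 ≤ D := (le_max_right _ _).trans (le_max_right _ _)
  refine ⟨c / D ^ m, by positivity, fun q hq => ?_⟩
  have hq1 := one_le_supNorm hq
  obtain ⟨j, hj, hjD⟩ : ∃ j, supNorm q ≤ Q j ∧ Q j ≤ D * supNorm q := by
    classical
    have hex := hunb (supNorm q)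
    refine ⟨Nat.find hex, Nat.find_spec hex, ?_⟩
    rcases hj : Nat.find hex with _ | j
    · nlinarith
    · have h1 : Q j < supNorm q := not_le.1 (Nat.find_min hex (by omega))
      calc Q (j + 1) ≤ C * Q j := hC j
        _ ≤ D * Q j := by have := hQ j; gcongr
        _ ≤ D * supNorm q := by gcongr
  obtain ⟨i, hi⟩ := h j q hq hj
  refine le_trans ?_ (le_ciSup (f := fun i => supNorm q ^ ((m : ℝ) * k i) *
    distNearestInt (linForm Θ q i - x i)) (Set.finite_range _).bddAbove i)
  have he : 0 ≤ (m : ℝ) * k i := mul_nonneg (Nat.cast_nonneg _) (hk.1 i).le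
  have hpow : Q j ^ ((m : ℝ) * k i) ≤ D ^ m * supNorm q ^ ((m : ℝ) * k i) := by
    refine (Real.rpow_le_rpow (hQ j).le hjD he).trans ?_
    rw [Real.mul_rpow (by linarith) (by linarith)]
    gcongr
    rw [← Real.rpow_natCast]
    exact Real.rpow_le_rpow_of_exponent_le hD1
      (mul_le_of_le_one_right (Nat.cast_nonneg _) (hk.le_one i))
  rw [div_le_iff₀ (by positivity)]
  calc c ≤ _ := hi
    _ ≤ D ^ m * supNorm q ^ ((m : ℝ) * k i) * distNearestInt (linForm Θ q i - x i) :=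
      mul_le_mul_of_nonneg_right hpow (distNearestInt_nonneg _)
    _ = _ := by ring

lemma padicValNat_two_pow_mul_odd (t j : ℕ) : padicValNat 2 (2 ^ t * (2 * j + 1)) = t := by
  rw [padicValNat.mul (by positivity) (by omega), padicValNat.prime_pow,
    padicValNat.eq_zero_of_not_dvd (by omega), add_zero]

/-- The parameters `y` for which `affineParam b φ y` lies in every twisted set have full Hausdorff
dimension. -/
lemma le_dimH_preimage_iInter_badT {n m d : ℕ} (hn : 0 < n) (hm : 0 < m) (hd : 1 ≤ d)
    (k : ℕ → Fin n → ℝ) (hk : ∀ t, IsWeight (k t))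
    (Θ : Matrix (Fin n) (Fin m) ℝ) (hΘ : ∀ t, Θ ∈ Bad n m (k t))
    (b : Fin n → ℝ) (φ : Fin n → Fin d → ℝ) (hφ : ∃ i, 0 < ∑ j, |φ i j|) :
    (d : ENNReal) ≤ dimH (affineParam b φ ⁻¹' ⋂ t, BadT n m (k t) Θ) := by
  have hΘ' : ∀ t, ∃ c : ℝ, 0 < c ∧ c ≤ 1 ∧ ∀ q : Fin m → ℤ, q ≠ 0 →
      ∃ i, c ≤ supNorm q ^ ((m : ℝ) * k t i) * distNearestInt (linForm Θ q i) := by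
    intro t
    obtain ⟨c, hc, h⟩ := hΘ t
    refine ⟨min c 1, lt_min hc one_pos, min_le_right _ _, fun q hq => ?_⟩
    obtain ⟨i, hi⟩ := exists_le_of_le_iSup_fin hn (h q hq)
    exact ⟨i, (min_le_left _ _).trans hi⟩
  choose c hc0 hc1 hc using hΘ'
  have hL0 : ∀ i, 0 ≤ ∑ j, |φ i j| := fun i => Finset.sum_nonneg fun j _ => abs_nonneg _
  have he : ∀ t i, 0 < (m : ℝ) * k t i := fun t i => mul_pos (by exact_mod_cast hm) ((hk t).1 i)
  refine le_of_forall_lt fun s hs => ?_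
  obtain ⟨s', hss', hs'd⟩ := ENNReal.lt_iff_exists_nnreal_btwn.1 hs
  refine hss'.trans_le ?_
  have hs'd' : (s' : ℝ) < d := by exact_mod_cast hs'd
  obtain ⟨K, M, hK, hM, hMK, hsM⟩ := exists_branching_log_ratio_ge hd hs'd'
  have hK' : (1 : ℝ) ≤ K := by exact_mod_cast hK
  have hc' : ∀ t, 0 < c t / (3 * 2 ^ m) := fun t => div_pos (hc0 t) (by positivity)
  have hQex : ∀ t l : ℕ, ∃ Q : ℝ, 0 < Q ∧
      (∀ i, (∑ j, |φ i j|) * (1 / (2 * K : ℝ) ^ l) * Q ^ ((m : ℝ) * k t i)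
        ≤ c t / (3 * 2 ^ m)) ∧
      ∃ i, 0 < ∑ j, |φ i j| ∧
        (∑ j, |φ i j|) * (1 / (2 * K : ℝ) ^ l) * Q ^ ((m : ℝ) * k t i) = c t / (3 * 2 ^ m) :=
    fun t l => exists_scale hL0 hφ (he t) (hc' t) (by positivity)
  choose Q hQ0 hQle hQeq using hQex
  let c₂ : ℕ → ℝ := fun t => c t / (3 * 2 ^ m) / (2 * K)
  have hc₂0 : ∀ t, 0 < c₂ t := fun t => div_pos (hc' t) (by positivity)
  have hc₂ : ∀ t, c₂ t ≤ c t / (3 * 2 ^ m) := fun t =>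
    div_le_self (hc' t).le (by linarith)
  let τ : ℕ → ℕ := fun l => padicValNat 2 (l + 1)
  let G : ℕ → Set (Fin d → ℝ) := fun l =>
    {y | AvoidsUpTo (k (τ l)) Θ (c₂ (τ l)) (Q (τ l) l) (affineParam b φ y)}
  have hdim : ENNReal.ofReal (Real.log M / Real.log (2 * K)) ≤ dimH (⋂ l, G l) := by
    refine le_dimH_iInter_of_children hK hM G fun l x => ?_
    obtain ⟨i₀, hi₀, hi₀eq⟩ := hQeq (τ l) l
    obtain ⟨a, ha⟩ := exists_slab_of_scale hm (hk (τ l)) (hc1 (τ l)) (hc (τ l)) b φ (hQ0 (τ l) l)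
      (hQle (τ l) l) (hc₂ (τ l)) i₀ x
    obtain ⟨S, hS, hSa⟩ := exists_children_avoiding_slab hK (φ i₀) hi₀ a l x
    refine ⟨S, hMK.trans hS, fun z hz y hy => ha y (gridCube_childCorner_subset x z hy) ?_⟩
    have h1 := mul_le_mul_of_nonneg_left (hSa z hz y hy)
      (Real.rpow_nonneg (hQ0 (τ l) l).le ((m : ℝ) * k (τ l) i₀))
    refine le_trans (le_of_eq ?_) h1
    simp only [c₂]
    rw [← hi₀eq, pow_succ]
    field_simp
  have hsub : (⋂ l, G l) ⊆ affineParam b φ ⁻¹' ⋂ t, BadT n m (k t) Θ := by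
    intro y hy
    rw [Set.mem_preimage, Set.mem_iInter]
    intro t
    let lv : ℕ → ℕ := fun j => 2 ^ t * (2 * j + 1) - 1
    have hlv : ∀ j, lv j + 1 = 2 ^ t * (2 * j + 1) := fun j =>
      Nat.sub_add_cancel (Nat.mul_pos (by positivity) (by omega))
    have hτ : ∀ j, τ (lv j) = t := fun j => by
      simp only [τ]
      rw [hlv, padicValNat_two_pow_mul_odd]
    have hstep : ∀ j, lv (j + 1) = lv j + 2 ^ (t + 1) := fun j => by
      have h1 := hlv (j + 1)
      have h2 := hlv j
      have h3 : 2 ^ t * (2 * (j + 1) + 1) = 2 ^ t * (2 * j + 1) + 2 ^ (t + 1) := by ring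
      omega
    obtain ⟨⟨C, hC⟩, hunb⟩ := scale_growth (R := (2 * K : ℝ) ^ 2 ^ (t + 1)) hL0 (he t) (hc' t)
      (one_lt_pow₀ (by linarith) (by positivity))
      (ρ := fun j => 1 / (2 * K : ℝ) ^ lv j) (Q := fun j => Q t (lv j))
      (fun j => by positivity)
      (fun j => by simp only [hstep, pow_add]; field_simp)
      (fun j => hQ0 _ _) (fun j => hQle _ _) (fun j => hQeq _ _)
    refine mem_badT_of_avoidsUpTo (hk t) (hc₂0 t) (fun j => hQ0 t (lv j)) hC hunb fun j => ?_
    have := Set.mem_iInter.1 hy (lv j)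
    simp only [G, Set.mem_ofPred_eq, hτ] at this
    exact this
  refine le_trans ?_ (hdim.trans (dimH_mono hsub))
  rw [← ENNReal.ofReal_coe_nnreal]
  exact ENNReal.ofReal_le_ofReal hsM

/-- If `Θ ∈ ⋂ₜ Bad(kₜ,n,m)` for a countable collection of weight
vectors, then for every `1 ≤ d ≤ n` and every `d`-dimensional affine subspace
`A ⊆ ℝⁿ`, `dim_H (⋂ₜ Bad_Θ(kₜ,n,m) ∩ A) = d`. -/
theorem iInter_badT_inter_affine_dimH {n m : ℕ} (hn : 0 < n) (hm : 0 < m)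
    (k : ℕ → Fin n → ℝ) (hk : ∀ t, IsWeight (k t))
    (Θ : Matrix (Fin n) (Fin m) ℝ) (hΘ : ∀ t, Θ ∈ Bad n m (k t))
    (d : ℕ) (hd : 1 ≤ d) (hdn : d ≤ n)
    (A : AffineSubspace ℝ (Fin n → ℝ))
    (hA : Module.finrank ℝ A.direction = d) :
    dimH ((⋂ t, BadT n m (k t) Θ) ∩ (A : Set (Fin n → ℝ))) = d := by
  have hAne : (A : Set (Fin n → ℝ)).Nonempty := by
    rw [AffineSubspace.nonempty_iff_ne_bot]
    rintro rfl
    rw [AffineSubspace.direction_bot, finrank_bot] at hA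
    omega
  apply le_antisymm
  · refine (dimH_mono Set.inter_subset_right).trans (le_of_eq ?_)
    rw [Real.Convex.dimH_eq_finrank_vectorSpan A.convex hAne,
      ← AffineSubspace.direction_eq_vectorSpan, hA]
  obtain ⟨b, hb⟩ := hAne
  let B := Module.finBasisOfFinrankEq ℝ A.direction hA
  let f : (Fin d → ℝ) →ₗ[ℝ] (Fin n → ℝ) :=
    A.direction.subtype ∘ₗ B.equivFun.symm.toLinearMap
  have hfinj : Function.Injective f :=
    Subtype.val_injective.comp B.equivFun.symm.injective
  let φ : Fin n → Fin d → ℝ := fun i j => f (Pi.single j 1) i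
  have hparam : ∀ y, affineParam b φ y = b + f y := by
    intro y
    funext i
    have h1 : f y = ∑ j, y j • f (Pi.single j 1) := by
      conv_lhs => rw [pi_eq_sum_univ' y]
      simp only [map_sum, map_smul]
    rw [Pi.add_apply, h1, Finset.sum_apply]
    simp only [affineParam, φ, Pi.smul_apply, smul_eq_mul, mul_comm]
  have hφ : ∃ i, 0 < ∑ j, |φ i j| := by
    let j₀ : Fin d := ⟨0, hd⟩
    have h1 : f (Pi.single j₀ 1) ≠ 0 := by
      rw [Ne, map_eq_zero_iff f hfinj]
      intro h
      simpa using congrFun h j₀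
    obtain ⟨i, hi⟩ := Function.ne_iff.1 h1
    refine ⟨i, (abs_pos.2 hi).trans_le ?_⟩
    exact Finset.single_le_sum (f := fun j => |φ i j|) (fun j _ => abs_nonneg _)
      (Finset.mem_univ j₀)
  obtain ⟨C, -, hC⟩ := f.exists_antilipschitzWith (LinearMap.ker_eq_bot.2 hfinj)
  have hanti : AntilipschitzWith C (affineParam b φ) := by
    intro y y'
    rw [hparam, hparam, edist_add_left]
    exact hC y y'
  refine (le_dimH_preimage_iInter_badT hn hm hd k hk Θ hΘ b φ hφ).trans
    ((hanti.le_dimH_image _).trans (dimH_mono ?_))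
  rintro _ ⟨y, hy, rfl⟩
  refine ⟨hy, ?_⟩
  rw [hparam, add_comm]
  exact AffineSubspace.vadd_mem_of_mem_direction (B.equivFun.symm y).2 hb
end

section
/- Let n, m be positive integers, k a weight vector, 1 ≤ t ≤ n−1, λ ≥ 1, 0 < γ < 1, T ≥ 1, and let Θ be an n×m real matrix such that max_{1≤i≤n} |u_i|^{1/(m k_i)} · max_{1≤j≤m} ‖Θ*_j(u)‖ > γ for all nonzero u ∈ ℤⁿ. If u ∈ ℤⁿ is nonzero with max_{1≤i≤n} |u_i|^{1/(m k_i)} = |u_{n−t}|^{1/(m k_{n−t})} and |u_{n−t}| ≤ γ^{−m} λ^t T^{m k_{n−t}}, then max_{1≤j≤m} ‖Θ*_j(u)‖ ≥ λ^{−t/(m k_{n−t})} γ^{1 + 1/k_{n−t}} T^{−1}. -/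
open Real MeasureTheory Topology

/-- (Inequality (P2) of §4.4: lower bound on `ψ(T)`.) If `u ∈ ℤⁿ`
is nonzero with `max_i |uᵢ|^{1/(m kᵢ)} = |u_{n−t}|^{1/(m k_{n−t})}` and
`|u_{n−t}| ≤ γ^{−m} λᵗ T^{m k_{n−t}}`, then
`max_j ‖Θ*ⱼ(u)‖ ≥ λ^{−t/(m k_{n−t})} γ^{1+1/k_{n−t}} T^{−1}`.
(`i₀` is the 0-based index of the coordinate `u_{n−t}`.) -/
theorem psi_lower_bound {n m : ℕ} (hm : 0 < m)
    (k : Fin n → ℝ) (hk : IsWeight k)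
    (t : ℕ) (ht : 1 ≤ t) (htn : t ≤ n - 1)
    (lam γ T : ℝ) (hlam : 1 ≤ lam) (hγ0 : 0 < γ) (hγ1 : γ < 1) (hT : 1 ≤ T)
    (Θ : Matrix (Fin n) (Fin m) ℝ)
    (hdual : ∀ u : Fin n → ℤ, u ≠ 0 →
      γ < (⨆ i, |(u i : ℝ)| ^ (1 / ((m : ℝ) * k i))) *
        ⨆ j, distNearestInt (dualForm Θ u j))
    (i₀ : Fin n) (hi₀ : (i₀ : ℕ) = n - t - 1)
    (u : Fin n → ℤ) (hu : u ≠ 0)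
    (hmax : (⨆ i, |(u i : ℝ)| ^ (1 / ((m : ℝ) * k i))) = (|u i₀| : ℝ) ^ (1 / ((m : ℝ) * k i₀)))
    (hub : (|u i₀| : ℝ) ≤ (γ ^ m)⁻¹ * lam ^ t * T ^ ((m : ℝ) * k i₀)) :
    lam ^ (-(t : ℝ) / ((m : ℝ) * k i₀)) * γ ^ (1 + 1 / k i₀) / T ≤
      ⨆ j, distNearestInt (dualForm Θ u j) := by
  have hm' : (0 : ℝ) < m := Nat.cast_pos.mpr hm
  have hk₀ : 0 < k i₀ := hk.1 i₀
  have hmk : 0 < (m : ℝ) * k i₀ := mul_pos hm' hk₀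
  have hlam0 : 0 < lam := by linarith
  have hT0 : 0 < T := by linarith
  have hψ : 0 ≤ ⨆ j, distNearestInt (dualForm Θ u j) :=
    Real.iSup_nonneg fun j => Real.iInf_nonneg fun p => abs_nonneg _
  have hpow : ((γ ^ m)⁻¹ * lam ^ t * T ^ ((m : ℝ) * k i₀)) ^ (1 / ((m : ℝ) * k i₀)) =
      γ ^ (-(1 / k i₀)) * lam ^ ((t : ℝ) / ((m : ℝ) * k i₀)) * T := by
    rw [Real.mul_rpow (by positivity) (by positivity),
      Real.mul_rpow (by positivity) (by positivity), ← Real.rpow_natCast γ m,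
      ← Real.rpow_neg hγ0.le, ← Real.rpow_natCast lam t, ← Real.rpow_mul hγ0.le,
      ← Real.rpow_mul hlam0.le, ← Real.rpow_mul hT0.le, mul_one_div_cancel hmk.ne',
      Real.rpow_one]
    congr 3 <;> field_simp
  have hγψ : γ ≤ γ ^ (-(1 / k i₀)) * lam ^ ((t : ℝ) / ((m : ℝ) * k i₀)) * T *
      ⨆ j, distNearestInt (dualForm Θ u j) := by
    refine (hdual u hu).le.trans (mul_le_mul_of_nonneg_right ?_ hψ)
    rw [hmax, ← hpow]
    exact Real.rpow_le_rpow (abs_nonneg _) hub (by positivity)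
  rw [neg_div, Real.rpow_neg hlam0.le, Real.rpow_add hγ0, Real.rpow_one, div_le_iff₀ hT0,
    inv_mul_le_iff₀ (by positivity)]
  rw [Real.rpow_neg hγ0.le, mul_assoc, mul_assoc, le_inv_mul_iff₀ (by positivity)] at hγψ
  linarith
end
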